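/- Let d ≥ 1 and κ > 0. There exists a constant C > 0 (depending only on d and κ) such that for every matrix M = n·a·k in the Siegel set S_d(κ) with 0 < a_d ≤ 1 (a_d the last diagonal entry of a), one has ‖M‖ ≤ C·a_d^{−(d−1)} and ‖M^{−1}‖ ≤ C·a_d^{−1}. -/

import Mathlib

open scoped BigOperators
open Matrix

noncomputable section

/-- `E^t = diag(e^{-t},…,e^{-t}, e^{(d-1)t})` on `ℝ^d` with `d = m+1`. -/
def Emat (m : ℕ) (t : ℝ) : Matrix (Fin (m+1)) (Fin (m+1)) ℝ :=
  Matrix.diagonal (Fin.snoc (fun _ : Fin m => Real.exp (-t)) (Real.exp ((m : ℝ) * t)))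

/-- The block matrix `[[1, α],[0, 1]]` (sizes `(m)+(1)`). -/
def blockU {m : ℕ} (α : Fin m → ℝ) : Matrix (Fin (m+1)) (Fin (m+1)) ℝ :=
  Matrix.of (Fin.snoc (fun i : Fin m =>
      Fin.snoc (fun j : Fin m => if i = j then (1:ℝ) else 0) (α i))
    (Fin.snoc (fun _ : Fin m => (0:ℝ)) 1))

/-- The block matrix `[[A, 0],[ᵀβ, γ]]` (sizes `(m)+(1)`). -/
def blockL {m : ℕ} (A : Matrix (Fin m) (Fin m) ℝ) (β : Fin m → ℝ) (γ : ℝ) :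
    Matrix (Fin (m+1)) (Fin (m+1)) ℝ :=
  Matrix.of (Fin.snoc (fun i : Fin m => Fin.snoc (fun j : Fin m => A i j) 0)
    (Fin.snoc β γ))

/-- `α ∈ ℝ^{d-1}` is Diophantine with exponent `ε` and constant `C`:
`|m|^{(d-1)(1+ε)} |m·α + k| > C` for all `m ∈ ℤ^{d-1} ∖ {0}`, `k ∈ ℤ` (max norm). -/
def DioVec {m : ℕ} (α : Fin m → ℝ) (ε C : ℝ) : Prop :=
  ∀ q : Fin m → ℤ, q ≠ 0 → ∀ k : ℤ,
    C < ‖((fun i => (q i : ℝ)) : Fin m → ℝ)‖ ^ ((m : ℝ) * (1 + ε)) *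
        |(∑ i, (q i : ℝ) * α i) + (k : ℝ)|

/-- The data of a Siegel-set decomposition `M = N ⬝ diagonal a ⬝ K` in `S_d(κ)`:
`N` unipotent upper triangular with entries bounded by `κ`, `a` positive with
product `1` and `a j ≥ (√3/2) a (j+1)`, and `K ∈ SO(d)`. -/
def IsSiegelTriple {m : ℕ} (κ : ℝ) (N K : Matrix (Fin (m+1)) (Fin (m+1)) ℝ)
    (a : Fin (m+1) → ℝ) : Prop :=
  (∀ i, N i i = 1) ∧ (∀ i j : Fin (m+1), j < i → N i j = 0) ∧
  (∀ i j : Fin (m+1), i < j → |N i j| ≤ κ) ∧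
  (∀ i, 0 < a i) ∧ (∏ i, a i = 1) ∧
  (∀ i : Fin m, Real.sqrt 3 / 2 * a i.succ ≤ a i.castSucc) ∧
  K * K.transpose = 1 ∧ K.det = 1

/-- Membership in the Siegel set `S_d(κ)`. -/
def InSiegelSet {m : ℕ} (κ : ℝ) (M : Matrix (Fin (m+1)) (Fin (m+1)) ℝ) : Prop :=
  ∃ N K a, IsSiegelTriple κ N K a ∧ M = N * Matrix.diagonal a * K

/-- Euclidean norm on `ℝ^n`. -/
def eucNorm {n : ℕ} (v : Fin n → ℝ) : ℝ := Real.sqrt (∑ i, v i ^ 2)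

/-- Operator norm of a matrix induced by the Euclidean norm. -/
def eucOpNorm {n : ℕ} (M : Matrix (Fin n) (Fin n) ℝ) : ℝ :=
  sSup {c | ∃ v : Fin n → ℝ, eucNorm v ≤ 1 ∧ c = eucNorm (M.mulVec v)}

/-- `δ(M) = inf_{k ∈ ℤ^d ∖ {0}} |ᵀk M|` (max norm). -/
def deltaFn {m : ℕ} (M : Matrix (Fin (m+1)) (Fin (m+1)) ℝ) : ℝ :=
  ⨅ k : {k : Fin (m+1) → ℤ // k ≠ 0}, ‖Matrix.vecMul (fun i => (k.1 i : ℝ)) M‖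

/-- `θ = (d-1)ε/(d + (d-1)ε)` with `d = m+1`. -/
def thetaOf (m : ℕ) (ε : ℝ) : ℝ := (m : ℝ) * ε / ((m + 1 : ℝ) + (m : ℝ) * ε)

end

theorem abs_le_eucNorm {n : ℕ} (v : Fin n → ℝ) (i : Fin n) : |v i| ≤ eucNorm v := by
  rw [← Real.sqrt_sq_eq_abs]
  exact Real.sqrt_le_sqrt
    (Finset.single_le_sum (f := fun j => v j ^ 2) (fun j _ => sq_nonneg _) (Finset.mem_univ i))

theorem eucNorm_le_of_abs_le {n : ℕ} {v : Fin n → ℝ} {B : ℝ} (hB : 0 ≤ B)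
    (h : ∀ i, |v i| ≤ B) : eucNorm v ≤ n * B := by
  refine Real.sqrt_le_iff.2 ⟨by positivity, ?_⟩
  have hsum : ∑ i, v i ^ 2 ≤ n * B ^ 2 := by
    refine (Finset.sum_le_card_nsmul _ _ (B ^ 2) fun i _ => ?_).trans_eq (by simp)
    exact sq_le_sq.2 ((h i).trans (le_abs_self B))
  have hn : (n : ℝ) ≤ n ^ 2 := by exact_mod_cast Nat.le_self_pow two_ne_zero n
  nlinarith [sq_nonneg B]

theorem eucOpNorm_le_of_abs_le {n : ℕ} {M : Matrix (Fin n) (Fin n) ℝ} {B : ℝ} (hB : 0 ≤ B)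
    (h : ∀ i j, |M i j| ≤ B) : eucOpNorm M ≤ n * (n * B) := by
  refine csSup_le ⟨_, 0, by simp [eucNorm], rfl⟩ ?_
  rintro _ ⟨v, hv, rfl⟩
  refine eucNorm_le_of_abs_le (by positivity) fun i => ?_
  have hterm : ∀ j ∈ Finset.univ, |M i j * v j| ≤ B := fun j _ => by
    rw [abs_mul]
    exact (mul_le_mul (h i j) ((abs_le_eucNorm v j).trans hv) (abs_nonneg _) hB).trans_eq
      (mul_one B)
  exact (Finset.abs_sum_le_sum_abs _ _).trans
    ((Finset.sum_le_card_nsmul _ _ B hterm).trans_eq (by simp))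

theorem abs_mul_diagonal_mul_apply_le {n : ℕ} {P Q : Matrix (Fin n) (Fin n) ℝ} {a : Fin n → ℝ}
    {p q A : ℝ} (hp : 0 ≤ p) (hA : 0 ≤ A) (hP : ∀ i j, |P i j| ≤ p)
    (hQ : ∀ i j, |Q i j| ≤ q) (ha : ∀ i, |a i| ≤ A) (i j : Fin n) :
    |(P * Matrix.diagonal a * Q) i j| ≤ n * (p * A * q) := by
  rw [Matrix.mul_apply]
  refine (Finset.abs_sum_le_sum_abs _ _).trans
    ((Finset.sum_le_card_nsmul _ _ (p * A * q) fun k _ => ?_).trans_eq (by simp))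
  rw [Matrix.mul_diagonal, abs_mul, abs_mul]
  exact mul_le_mul (mul_le_mul (hP i k) (ha k) (abs_nonneg _) hp) (hQ k j) (abs_nonneg _)
    (mul_nonneg hp hA)

theorem abs_apply_le_one_of_mul_transpose_eq_one {n : ℕ} {K : Matrix (Fin n) (Fin n) ℝ}
    (hK : K * K.transpose = 1) (i j : Fin n) : |K i j| ≤ 1 := by
  have hrow : ∑ k, K i k ^ 2 = 1 := by
    simpa [Matrix.mul_apply, sq] using congrFun (congrFun hK i) i
  simpa [eucNorm, hrow] using abs_le_eucNorm (K i) j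

/-- Cramer's rule bounds the entries of the adjugate by a polynomial in a bound on the entries. -/
theorem abs_adjugate_apply_le {n : ℕ} {N : Matrix (Fin n) (Fin n) ℝ} {x : ℝ} (hx : 1 ≤ x)
    (h : ∀ i j, |N i j| ≤ x) (i j : Fin n) : |N.adjugate i j| ≤ n.factorial * x ^ n := by
  rw [Matrix.adjugate_apply]
  have hentry : ∀ k l, AbsoluteValue.abs (N.updateRow j (Pi.single i 1) k l) ≤ x := by
    intro k l
    rw [AbsoluteValue.abs_apply, Matrix.updateRow_apply]
    split_ifs
    · rw [Pi.single_apply]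
      split_ifs
      · simpa using hx
      · simpa using zero_le_one.trans hx
    · exact h k l
  simpa [nsmul_eq_mul] using Matrix.det_le hentry

namespace IsSiegelTriple

variable {m : ℕ} {κ : ℝ} {N K : Matrix (Fin (m+1)) (Fin (m+1)) ℝ} {a : Fin (m+1) → ℝ}

theorem abs_unipotent_apply_le (h : IsSiegelTriple κ N K a) (i j : Fin (m+1)) :
    |N i j| ≤ max 1 κ := by
  obtain ⟨h1, h2, h3, -⟩ := h
  rcases lt_trichotomy i j with hij | rfl | hij
  · exact (h3 i j hij).trans (le_max_right _ _)
  · simp [h1]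
  · simp [h2 i j hij]

theorem det_unipotent (h : IsSiegelTriple κ N K a) : N.det = 1 := by
  obtain ⟨h1, h2, -⟩ := h
  rw [Matrix.det_of_isUpperTriangular fun i j hij => h2 i j hij]
  simp [h1]

theorem abs_inv_unipotent_apply_le (h : IsSiegelTriple κ N K a) (i j : Fin (m+1)) :
    |N⁻¹ i j| ≤ (m+1).factorial * max 1 κ ^ (m+1) := by
  rw [Matrix.inv_def, h.det_unipotent, Ring.inverse_one, one_smul]
  exact abs_adjugate_apply_le (le_max_left _ _) h.abs_unipotent_apply_le i j

theorem pow_mul_last_le (h : IsSiegelTriple κ N K a) (i : Fin (m+1)) :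
    (Real.sqrt 3 / 2) ^ m * a (Fin.last m) ≤ a i := by
  obtain ⟨-, -, -, hpos, -, hstep, -⟩ := h
  have hs0 : 0 ≤ Real.sqrt 3 / 2 := by positivity
  have hs1 : Real.sqrt 3 / 2 ≤ 1 := by
    rw [div_le_one two_pos, Real.sqrt_le_left two_pos.le]
    norm_num
  have key : (Real.sqrt 3 / 2) ^ (m - (i : ℕ)) * a (Fin.last m) ≤ a i := by
    induction i using Fin.reverseInduction with
    | last => simp
    | cast i ih =>
      refine le_trans ?_ (hstep i)
      have hexp : m - (i.castSucc : ℕ) = (m - (i.succ : ℕ)) + 1 := by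
        simp only [Fin.val_castSucc, Fin.val_succ]
        omega
      rw [hexp, pow_succ', mul_assoc]
      exact mul_le_mul_of_nonneg_left ih hs0
  exact (mul_le_mul_of_nonneg_right (pow_le_pow_of_le_one hs0 hs1 (Nat.sub_le _ _))
    (hpos _).le).trans key

theorem diagonal_apply_le (h : IsSiegelTriple κ N K a) (i : Fin (m+1)) :
    a i ≤ (((Real.sqrt 3 / 2) ^ m * a (Fin.last m)) ^ m)⁻¹ := by
  have hlow := h.pow_mul_last_le
  obtain ⟨-, -, -, hpos, hprod, -⟩ := h
  have hlast := hpos (Fin.last m)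
  have hr : 0 < (Real.sqrt 3 / 2) ^ m * a (Fin.last m) := by positivity
  have hle : ((Real.sqrt 3 / 2) ^ m * a (Fin.last m)) ^ m ≤ ∏ j ∈ Finset.univ.erase i, a j := by
    simpa using Finset.prod_le_prod (s := Finset.univ.erase i) (fun _ _ => hr.le)
      (fun j _ => hlow j)
  rw [← Finset.mul_prod_erase _ _ (Finset.mem_univ i)] at hprod
  rw [← one_div, le_div_iff₀ (by positivity), ← hprod]
  exact mul_le_mul_of_nonneg_left hle (hpos i).le

theorem inv_eq (h : IsSiegelTriple κ N K a) :
    (N * Matrix.diagonal a * K)⁻¹ = K.transpose * Matrix.diagonal (fun i => (a i)⁻¹) * N⁻¹ := by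
  obtain ⟨-, -, -, hpos, -, -, hK, -⟩ := h
  have hD : (Matrix.diagonal a)⁻¹ = Matrix.diagonal (fun i => (a i)⁻¹) := by
    refine Matrix.inv_eq_right_inv ?_
    rw [Matrix.diagonal_mul_diagonal, ← Matrix.diagonal_one]
    exact congrArg _ (funext fun i => mul_inv_cancel₀ (hpos i).ne')
  rw [Matrix.mul_inv_rev, Matrix.mul_inv_rev, hD, Matrix.inv_eq_right_inv hK, mul_assoc]

end IsSiegelTriple

/-- On a Siegel set `S_d(κ)`, for `M = n·a·k` with `0 < a_d ≤ 1`
one has `‖M‖ ≤ C a_d^{-(d-1)}` and `‖M⁻¹‖ ≤ C a_d⁻¹`, for a constant `C` depending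
only on `d` and `κ` (operator norms w.r.t. the Euclidean norm). -/
theorem siegel_norm_estimates (m : ℕ) (κ : ℝ) (hκ : 0 < κ) :
    ∃ C > (0:ℝ), ∀ (N K : Matrix (Fin (m+1)) (Fin (m+1)) ℝ) (a : Fin (m+1) → ℝ),
      IsSiegelTriple κ N K a → a (Fin.last m) ≤ 1 →
      eucOpNorm (N * Matrix.diagonal a * K) ≤ C * ((a (Fin.last m)) ^ m)⁻¹ ∧
      eucOpNorm ((N * Matrix.diagonal a * K)⁻¹) ≤ C * (a (Fin.last m))⁻¹ := by
  set n : ℝ := ((m + 1 : ℕ) : ℝ)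
  set s : ℝ := (Real.sqrt 3 / 2) ^ m
  set x : ℝ := max 1 κ
  set y : ℝ := (m+1).factorial * x ^ (m+1)
  have hs0 : 0 < s := by positivity
  have hx0 : 0 < x := lt_max_of_lt_left one_pos
  have hn0 : 0 < n := by positivity
  have hy0 : 0 < y := by positivity
  refine ⟨max (n * (n * (n * (x * (s ^ m)⁻¹)))) (n * (n * (n * (s⁻¹ * y)))),
    lt_max_of_lt_left (by positivity), fun N K a h _ => ?_⟩
  have hpos : ∀ i, 0 < a i := h.2.2.2.1
  have hK : K * K.transpose = 1 := h.2.2.2.2.2.2.1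
  have hlast := hpos (Fin.last m)
  have hKle := abs_apply_le_one_of_mul_transpose_eq_one hK
  constructor
  · have hA : ∀ i, |a i| ≤ ((s * a (Fin.last m)) ^ m)⁻¹ := fun i => by
      rw [abs_of_pos (hpos i)]
      exact h.diagonal_apply_le i
    refine (eucOpNorm_le_of_abs_le (by positivity) (abs_mul_diagonal_mul_apply_le hx0.le
      (by positivity) h.abs_unipotent_apply_le hKle hA)).trans ?_
    refine le_trans (le_of_eq ?_) (mul_le_mul_of_nonneg_right (le_max_left _ _) (by positivity))
    rw [mul_pow, mul_inv]
    ring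
  · have hA : ∀ i, |(a i)⁻¹| ≤ (s * a (Fin.last m))⁻¹ := fun i => by
      rw [abs_of_pos (inv_pos.2 (hpos i))]
      exact inv_anti₀ (by positivity) (h.pow_mul_last_le i)
    rw [h.inv_eq]
    refine (eucOpNorm_le_of_abs_le (by positivity) (abs_mul_diagonal_mul_apply_le zero_le_one
      (by positivity) (fun i j => hKle j i) h.abs_inv_unipotent_apply_le hA)).trans ?_
    refine le_trans (le_of_eq ?_) (mul_le_mul_of_nonneg_right (le_max_right _ _) (by positivity))
    rw [mul_inv]
    ring
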